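/- Let (𝔤, [,], β) be an involutive color hom-Lie algebra and suppose (U(𝔤), φ_𝔤) satisfies the universal property of the enveloping algebra with respect to all involutive hom-associative color algebras. Then (U(𝔤), φ_𝔤) satisfies the universal property with respect to all hom-associative color algebras. -/

import Mathlib

/-- A hom-associative color algebra with bicharacter `ε`. -/
structure HomAssocColor (k Γ A : Type) [Field k] [AddCommGroup Γ]
    [AddCommGroup A] [Module k A] where
  mul : A →ₗ[k] A →ₗ[k] A
  alpha : A →ₗ[k] A
  grading : Γ → Submodule k A
  ε : Γ → Γ → k
  ε_ne_zero : ∀ a b, ε a b ≠ 0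
  ε_add_left : ∀ a b c, ε (a + b) c = ε a c * ε b c
  ε_add_right : ∀ a b c, ε a (b + c) = ε a b * ε a c
  ε_symm : ∀ a b, ε a b * ε b a = 1
  grade_mul : ∀ a b, ∀ x ∈ grading a, ∀ y ∈ grading b, mul x y ∈ grading (a + b)
  alpha_even : ∀ a, ∀ x ∈ grading a, alpha x ∈ grading a
  alpha_mul : ∀ x y, alpha (mul x y) = mul (alpha x) (alpha y)
  hassoc : ∀ x y z, mul (alpha x) (mul y z) = mul (mul x y) (alpha z)

/-- A color hom-Lie algebra: `ε`-skew-symmetric bracket satisfying the `ε`-hom-Jacobi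
identity, with even twist `α`. -/
structure ColorHomLie (k Γ L : Type) [Field k] [AddCommGroup Γ]
    [AddCommGroup L] [Module k L] where
  bracket : L →ₗ[k] L →ₗ[k] L
  alpha : L →ₗ[k] L
  grading : Γ → Submodule k L
  ε : Γ → Γ → k
  ε_ne_zero : ∀ a b, ε a b ≠ 0
  ε_add_left : ∀ a b c, ε (a + b) c = ε a c * ε b c
  ε_add_right : ∀ a b c, ε a (b + c) = ε a b * ε a c
  ε_symm : ∀ a b, ε a b * ε b a = 1
  grade_bracket : ∀ a b, ∀ x ∈ grading a, ∀ y ∈ grading b, bracket x y ∈ grading (a + b)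
  alpha_even : ∀ a, ∀ x ∈ grading a, alpha x ∈ grading a
  skew : ∀ a b, ∀ x ∈ grading a, ∀ y ∈ grading b, bracket x y = - ε a b • bracket y x
  jacobi : ∀ a b c, ∀ x ∈ grading a, ∀ y ∈ grading b, ∀ z ∈ grading c,
    ε c a • bracket (alpha x) (bracket y z) + ε b c • bracket (alpha z) (bracket x y)
      + ε a b • bracket (alpha y) (bracket z x) = 0

section ColorDefs
variable {k Γ : Type} [Field k] [AddCommGroup Γ]

/-- A morphism of color hom-Lie algebras from `g` into the `ε`-antisymmetrization of a
hom-associative color algebra `As`: degree zero, intertwines twists, sends brackets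
to `ε`-commutators. -/
def IsLieToAssocMorphism {L A : Type} [AddCommGroup L] [Module k L]
    [AddCommGroup A] [Module k A]
    (g : ColorHomLie k Γ L) (As : HomAssocColor k Γ A) (f : L →ₗ[k] A) : Prop :=
  (∀ γ, ∀ x ∈ g.grading γ, f x ∈ As.grading γ) ∧
  (∀ x, f (g.alpha x) = As.alpha (f x)) ∧
  (∀ γa γb, ∀ x ∈ g.grading γa, ∀ y ∈ g.grading γb,
    f (g.bracket x y) = As.mul (f x) (f y) - g.ε γa γb • As.mul (f y) (f x))

/-- A morphism of hom-associative color algebras. -/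
def IsAssocMorphism {A B : Type} [AddCommGroup A] [Module k A]
    [AddCommGroup B] [Module k B]
    (As : HomAssocColor k Γ A) (Bs : HomAssocColor k Γ B) (F : A →ₗ[k] B) : Prop :=
  (∀ γ, ∀ x ∈ As.grading γ, F x ∈ Bs.grading γ) ∧
  (∀ x, F (As.alpha x) = Bs.alpha (F x)) ∧
  (∀ x y, F (As.mul x y) = Bs.mul (F x) (F y))

/-- `(U, Us, φ)` is a universal enveloping hom-associative color algebra of `g`. -/
def IsUEA {L : Type} [AddCommGroup L] [Module k L]
    (g : ColorHomLie k Γ L)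
    (U : Type) [AddCommGroup U] [Module k U]
    (Us : HomAssocColor k Γ U) (φ : L →ₗ[k] U) : Prop :=
  Us.ε = g.ε ∧ IsLieToAssocMorphism g Us φ ∧
  ∀ (A : Type) [AddCommGroup A] [Module k A], ∀ (As : HomAssocColor k Γ A),
    As.ε = g.ε → ∀ f : L →ₗ[k] A, IsLieToAssocMorphism g As f →
      ∃! F : U →ₗ[k] A, IsAssocMorphism Us As F ∧ F ∘ₗ φ = f

end ColorDefs

/-- The elements of a hom-associative color algebra fixed by the square of the twist. -/
def HomAssocColor.involutiveSubmodule {k Γ A : Type} [Field k] [AddCommGroup Γ]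
    [AddCommGroup A] [Module k A] (As : HomAssocColor k Γ A) : Submodule k A :=
  LinearMap.eqLocus (As.alpha ∘ₗ As.alpha) LinearMap.id

theorem HomAssocColor.mem_involutiveSubmodule {k Γ A : Type} [Field k] [AddCommGroup Γ]
    [AddCommGroup A] [Module k A] (As : HomAssocColor k Γ A) {x : A} :
    x ∈ As.involutiveSubmodule ↔ As.alpha (As.alpha x) = x :=
  Iff.rfl

theorem HomAssocColor.mul_mem_involutiveSubmodule {k Γ A : Type} [Field k] [AddCommGroup Γ]
    [AddCommGroup A] [Module k A] (As : HomAssocColor k Γ A) {x y : A}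
    (hx : x ∈ As.involutiveSubmodule) (hy : y ∈ As.involutiveSubmodule) :
    As.mul x y ∈ As.involutiveSubmodule := by
  rw [As.mem_involutiveSubmodule] at *
  rw [As.alpha_mul, As.alpha_mul, hx, hy]

theorem HomAssocColor.alpha_mem_involutiveSubmodule {k Γ A : Type} [Field k] [AddCommGroup Γ]
    [AddCommGroup A] [Module k A] (As : HomAssocColor k Γ A) {x : A}
    (hx : x ∈ As.involutiveSubmodule) : As.alpha x ∈ As.involutiveSubmodule := by
  rw [As.mem_involutiveSubmodule] at *
  rw [hx]

/-- The involutive subalgebra of a hom-associative color algebra, with the induced structure. -/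
def HomAssocColor.involutivePart {k Γ A : Type} [Field k] [AddCommGroup Γ]
    [AddCommGroup A] [Module k A] (As : HomAssocColor k Γ A) :
    HomAssocColor k Γ As.involutiveSubmodule where
  mul := LinearMap.mk₂ k
    (fun x y => ⟨As.mul x y, As.mul_mem_involutiveSubmodule x.2 y.2⟩)
    (fun _ _ _ => Subtype.ext (by simp)) (fun _ _ _ => Subtype.ext (by simp))
    (fun _ _ _ => Subtype.ext (by simp)) (fun _ _ _ => Subtype.ext (by simp))
  alpha := As.alpha.restrict fun _ hx => As.alpha_mem_involutiveSubmodule hx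
  grading γ := (As.grading γ).comap As.involutiveSubmodule.subtype
  ε := As.ε
  ε_ne_zero := As.ε_ne_zero
  ε_add_left := As.ε_add_left
  ε_add_right := As.ε_add_right
  ε_symm := As.ε_symm
  grade_mul a b x hx y hy := As.grade_mul a b x hx y hy
  alpha_even a x hx := As.alpha_even a x hx
  alpha_mul x y := Subtype.ext (As.alpha_mul x y)
  hassoc x y z := Subtype.ext (As.hassoc x y z)

/-- A morphism of hom-associative color algebras out of an algebra generated by the range of `φ`
is determined by its composition with `φ`. -/
theorem IsAssocMorphism.eq_of_comp_eq {k Γ L U A : Type} [Field k] [AddCommGroup Γ]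
    [AddCommGroup L] [Module k L] [AddCommGroup U] [Module k U] [AddCommGroup A] [Module k A]
    {Us : HomAssocColor k Γ U} {As : HomAssocColor k Γ A} {φ : L →ₗ[k] U}
    (hgen : ∀ S : Submodule k U, LinearMap.range φ ≤ S →
      (∀ x ∈ S, ∀ y ∈ S, Us.mul x y ∈ S) → (∀ x ∈ S, Us.alpha x ∈ S) → ∀ u, u ∈ S)
    {F G : U →ₗ[k] A} (hF : IsAssocMorphism Us As F) (hG : IsAssocMorphism Us As G)
    (h : F ∘ₗ φ = G ∘ₗ φ) : F = G := by
  refine LinearMap.ext fun u => hgen (LinearMap.eqLocus F G) ?_ ?_ ?_ u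
  · rintro _ ⟨x, rfl⟩
    exact LinearMap.congr_fun h x
  · intro x hx y hy
    rw [LinearMap.mem_eqLocus] at *
    rw [hF.2.2, hG.2.2, hx, hy]
  · intro x hx
    rw [LinearMap.mem_eqLocus] at *
    rw [hF.2.1, hG.2.1, hx]

/-- if `(U, φ)` satisfies the universal property of the enveloping algebra
with respect to all involutive hom-associative color algebras, it satisfies it with
respect to all hom-associative color algebras. -/
theorem stmt6 {k Γ L U : Type} [Field k] [AddCommGroup Γ] [AddCommGroup L] [Module k L]
    [AddCommGroup U] [Module k U]
    (g : ColorHomLie k Γ L) (hinv : ∀ x, g.alpha (g.alpha x) = x)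
    (Us : HomAssocColor k Γ U) (φ : L →ₗ[k] U)
    (hε : Us.ε = g.ε) (hφ : IsLieToAssocMorphism g Us φ)
    (hgen : ∀ S : Submodule k U, LinearMap.range φ ≤ S →
      (∀ x ∈ S, ∀ y ∈ S, Us.mul x y ∈ S) → (∀ x ∈ S, Us.alpha x ∈ S) → ∀ u, u ∈ S)
    (huniv : ∀ (A : Type) [AddCommGroup A] [Module k A], ∀ (As : HomAssocColor k Γ A),
      As.ε = g.ε → (∀ a, As.alpha (As.alpha a) = a) →
      ∀ f : L →ₗ[k] A, IsLieToAssocMorphism g As f →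
        ∃! F : U →ₗ[k] A, IsAssocMorphism Us As F ∧ F ∘ₗ φ = f) :
    IsUEA g U Us φ := by
  refine ⟨hε, hφ, fun A _ _ As hAε f hf => ?_⟩
  have hmem : ∀ x, f x ∈ As.involutiveSubmodule := fun x => by
    rw [As.mem_involutiveSubmodule, ← hf.2.1, ← hf.2.1, hinv]
  obtain ⟨F, ⟨hF, hFφ⟩, -⟩ := huniv As.involutiveSubmodule As.involutivePart hAε
    (fun a => Subtype.ext a.2) (f.codRestrict As.involutiveSubmodule hmem)
    ⟨hf.1, fun x => Subtype.ext (hf.2.1 x),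
      fun a b x hx y hy => Subtype.ext (hf.2.2 a b x hx y hy)⟩
  have hF' : IsAssocMorphism Us As (As.involutiveSubmodule.subtype ∘ₗ F) :=
    ⟨hF.1, fun x => congrArg Subtype.val (hF.2.1 x),
      fun x y => congrArg Subtype.val (hF.2.2 x y)⟩
  have hF'φ : (As.involutiveSubmodule.subtype ∘ₗ F) ∘ₗ φ = f := by
    rw [LinearMap.comp_assoc, hFφ, LinearMap.subtype_comp_codRestrict]
  exact ⟨_, ⟨hF', hF'φ⟩, fun G hG => hG.1.eq_of_comp_eq hgen hF' (hG.2.trans hF'φ.symm)⟩
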